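/- Let ν be a Lévy measure on ℝ^d with ∫_{‖u‖≥1} ‖u‖ ν(du) < ∞ and polar decomposition ν(du) = 1_{(0,∞)}(r) 1_{S^{d−1}}(x) (k_x(r)/r) dr σ(dx), where σ is a finite positive measure on S^{d−1} and k_x(r) ≥ 0 is continuous and nonincreasing in r, continuous in x, with lim_{r→∞} k_x(r) = 0 and lim_{r→0⁺} r²k_x(r) = 0. Define, for f ∈ S(ℝ^d), A(f)(x) = −⟨x, ∇f(x)⟩ + ∫_{ℝ^d} ⟨∇f(x+u) − ∇f(x), u⟩ ν(du), Γ₁(f,g) = ½(A(fg) − fA(g) − gA(f)) and Γ₂(f,g) = ½( A(Γ₁(f,g)) − Γ₁(A(f),g) − Γ₁(A(g),f) ). Then for all f, g ∈ S(ℝ^d) and all x ∈ ℝ^d: Γ₂(f,g)(x) = (2π)^{−2d} ∫∫ F(f)(ξ) F(g)(ζ) e^{i⟨x, ξ+ζ⟩} ( σ_ν̃(ξ,ζ)²/4 + ρ_ν̃(ξ,ζ)/4 ) dξ dζ, where σ_ν̃(ξ,ζ) = ∫ (e^{i⟨u,ξ⟩} − 1)(e^{i⟨u,ζ⟩} − 1)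 ν̃(du) and ρ_ν̃(ξ,ζ) = ∫ i⟨u,ζ⟩ e^{i⟨u,ζ⟩}(e^{i⟨u,ξ⟩} − 1) ν̃(du) + ∫ i⟨u,ξ⟩ e^{i⟨u,ξ⟩}(e^{i⟨u,ζ⟩} − 1) ν̃(du), with ν̃(du) = 1_{(0,∞)}(r)1_{S^{d−1}}(x)(−dk_x(r)) σ(dx). -/

import Mathlib

open MeasureTheory ProbabilityTheory Filter Set
open scoped RealInnerProductSpace ENNReal NNReal Topology

noncomputable section

/-- A Lévy measure on `ℝ^d`. -/
def IsLevyMeasure {d : ℕ} (ν : Measure (EuclideanSpace ℝ (Fin d))) : Prop :=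
  ν {0} = 0 ∧ ∫⁻ u, ENNReal.ofReal (min 1 (‖u‖ ^ 2)) ∂ν < ⊤

/-- The non-local Ornstein–Uhlenbeck-type generator
`A(F)(x) = −⟨x, ∇F(x)⟩ + ∫ ⟨∇F(x+u) − ∇F(x), u⟩ ν(du)`. -/
def Aop {d : ℕ} (ν : Measure (EuclideanSpace ℝ (Fin d)))
    (F : EuclideanSpace ℝ (Fin d) → ℝ) (x : EuclideanSpace ℝ (Fin d)) : ℝ :=
  -⟪x, gradient F x⟫ + ∫ u, ⟪gradient F (x + u) - gradient F x, u⟫ ∂ν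

/-- The carré du champs operator `Γ₁` associated with `Aop`. -/
def Gam1 {d : ℕ} (ν : Measure (EuclideanSpace ℝ (Fin d)))
    (F G : EuclideanSpace ℝ (Fin d) → ℝ) (x : EuclideanSpace ℝ (Fin d)) : ℝ :=
  (Aop ν (fun y => F y * G y) x - F x * Aop ν G x - G x * Aop ν F x) / 2

/-- The iterated carré du champs operator `Γ₂` associated with `Aop`. -/
def Gam2 {d : ℕ} (ν : Measure (EuclideanSpace ℝ (Fin d)))
    (F G : EuclideanSpace ℝ (Fin d) → ℝ) (x : EuclideanSpace ℝ (Fin d)) : ℝ :=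
  (Aop ν (Gam1 ν F G) x - Gam1 ν (Aop ν F) G x - Gam1 ν (Aop ν G) F x) / 2

/-- The Fourier transform `F(f)(ξ) = ∫ f(x) e^{−i⟨ξ,x⟩} dx` of a real function on `ℝ^d`. -/
def FT {d : ℕ} (f : EuclideanSpace ℝ (Fin d) → ℝ) (ξ : EuclideanSpace ℝ (Fin d)) : ℂ :=
  ∫ y, (f y : ℂ) * Complex.exp (-(Complex.I * ((⟪ξ, y⟫ : ℝ) : ℂ)))

set_option linter.unusedSectionVars false

section Weight

variable {E : Type*} [NormedAddCommGroup E]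

/-- The weight `‖u‖ min(‖u‖, 1)`, integrable for the Lévy measures considered here. -/
def levyWeight (u : E) : ℝ := ‖u‖ * min ‖u‖ 1

theorem levyWeight_nonneg (u : E) : 0 ≤ levyWeight u := by
  unfold levyWeight
  positivity

theorem continuous_levyWeight : Continuous (levyWeight : E → ℝ) := by
  unfold levyWeight
  fun_prop

end Weight

section PlaneWaves

variable {E : Type*} [NormedAddCommGroup E] [InnerProductSpace ℝ E]

/-- The plane wave `e^{i⟨x,ξ⟩}`. -/
def planeWave (x ξ : E) : ℂ := Complex.exp (Complex.I * ((⟪x, ξ⟫ : ℝ) : ℂ))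

theorem norm_planeWave (x ξ : E) : ‖planeWave x ξ‖ = 1 := by
  rw [planeWave, mul_comm, Complex.norm_exp_ofReal_mul_I]

theorem planeWave_add_left (x u ξ : E) :
    planeWave (x + u) ξ = planeWave x ξ * planeWave u ξ := by
  rw [planeWave, planeWave, planeWave, ← Complex.exp_add, inner_add_left]
  push_cast
  ring_nf

theorem planeWave_add_right (x ξ ζ : E) :
    planeWave x (ξ + ζ) = planeWave x ξ * planeWave x ζ := by
  rw [planeWave, planeWave, planeWave, ← Complex.exp_add, inner_add_right]
  push_cast
  ring_nf

@[fun_prop]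
theorem Continuous.planeWave {X : Type*} [TopologicalSpace X] {f g : X → E}
    (hf : Continuous f) (hg : Continuous g) : Continuous fun z => planeWave (f z) (g z) := by
  unfold _root_.planeWave
  fun_prop

theorem hasFDerivAt_planeWave (x ξ : E) :
    HasFDerivAt (fun y => planeWave y ξ)
      ((planeWave x ξ * Complex.I) • Complex.ofRealCLM.comp (innerSL ℝ ξ)) x := by
  have h1 : HasFDerivAt (fun y : E => ((⟪y, ξ⟫ : ℝ) : ℂ))
      (Complex.ofRealCLM.comp (innerSL ℝ ξ)) x := by
    have := (Complex.ofRealCLM.comp (innerSL ℝ ξ)).hasFDerivAt (x := x)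
    refine this.congr_of_eventuallyEq (Eventually.of_forall fun y => ?_)
    simp [real_inner_comm]
  have h2 := (h1.const_mul Complex.I).cexp
  refine h2.congr_fderiv ?_
  rw [smul_smul]
  rfl

theorem norm_planeWave_sub_one_le (u ξ : E) :
    ‖planeWave u ξ - 1‖ ≤ 2 * (1 + ‖ξ‖) * min ‖u‖ 1 := by
  have h1 : ‖planeWave u ξ - 1‖ ≤ ‖u‖ * ‖ξ‖ :=
    (Real.norm_exp_I_mul_ofReal_sub_one_le (x := ⟪u, ξ⟫)).trans (norm_inner_le_norm u ξ)
  have h2 : ‖planeWave u ξ - 1‖ ≤ 2 := by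
    refine (norm_sub_le _ _).trans ?_
    rw [norm_planeWave, norm_one]
    norm_num
  have h3 := norm_nonneg ξ
  have h4 := norm_nonneg u
  rcases min_cases ‖u‖ 1 with ⟨h, _⟩ | ⟨h, _⟩ <;> rw [h] <;> nlinarith [mul_nonneg h3 h4]

theorem norm_I_mul_inner_le (u ξ : E) :
    ‖Complex.I * ((⟪u, ξ⟫ : ℝ) : ℂ)‖ ≤ ‖u‖ * (1 + ‖ξ‖) := by
  rw [norm_mul, Complex.norm_I, one_mul, Complex.norm_real]
  refine (norm_inner_le_norm u ξ).trans ?_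
  gcongr
  linarith

end PlaneWaves

section Moments

variable {E : Type*} [NormedAddCommGroup E] [MeasurableSpace E]
  {Ω : Type*} [MeasurableSpace Ω] {μ : Measure Ω} {p : Ω → E} {a : Ω → ℂ}

/-- The complex density `a` with respect to `μ` has finite moments of all orders in the
frequency variable `p`. -/
structure HasMoments (μ : Measure Ω) (p : Ω → E) (a : Ω → ℂ) : Prop where
  measurable : Measurable p
  aestronglyMeasurable : AEStronglyMeasurable a μ
  integrable : ∀ n : ℕ, Integrable (fun ω => (1 + ‖p ω‖) ^ n * ‖a ω‖) μ

theorem HasMoments.integrable_of_le (ha : HasMoments μ p a) {c : Ω → ℂ}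
    (hc : AEStronglyMeasurable c μ) {C : ℝ} {n : ℕ}
    (h : ∀ ω, ‖c ω‖ ≤ C * (1 + ‖p ω‖) ^ n * ‖a ω‖) : Integrable c μ :=
  ((ha.integrable n).const_mul C).mono' hc
    (Eventually.of_forall fun ω => (h ω).trans (le_of_eq (by ring)))

variable [OpensMeasurableSpace E]

theorem HasMoments.weight_measurable (ha : HasMoments μ p a) (k : ℕ) :
    Measurable fun ω => (1 + ‖p ω‖) ^ k :=
  (ha.measurable.norm.const_add 1).pow_const k

theorem HasMoments.mul (ha : HasMoments μ p a) {m : Ω → ℂ} (hm : AEStronglyMeasurable m μ)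
    {C : ℝ} {n : ℕ} (h : ∀ ω, ‖m ω‖ ≤ C * (1 + ‖p ω‖) ^ n) :
    HasMoments μ p fun ω => a ω * m ω := by
  refine ⟨ha.measurable, ha.aestronglyMeasurable.mul hm, fun k => ?_⟩
  have h1 : AEStronglyMeasurable (fun ω => (1 + ‖p ω‖) ^ k * ‖a ω * m ω‖) μ := by
    exact (ha.weight_measurable k).aestronglyMeasurable.mul
      (ha.aestronglyMeasurable.mul hm).norm
  refine ((ha.integrable (k + n)).const_mul C).mono' h1 (Eventually.of_forall fun ω => ?_)
  rw [Real.norm_of_nonneg (by positivity), norm_mul]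
  calc (1 + ‖p ω‖) ^ k * (‖a ω‖ * ‖m ω‖)
      ≤ (1 + ‖p ω‖) ^ k * (‖a ω‖ * (C * (1 + ‖p ω‖) ^ n)) := by gcongr; exact h ω
    _ = C * ((1 + ‖p ω‖) ^ (k + n) * ‖a ω‖) := by ring

theorem HasMoments.add (ha : HasMoments μ p a) {b : Ω → ℂ} (hb : HasMoments μ p b) :
    HasMoments μ p fun ω => a ω + b ω := by
  refine ⟨ha.measurable, ha.aestronglyMeasurable.add hb.aestronglyMeasurable, fun k => ?_⟩
  have h0 := ha.aestronglyMeasurable.add hb.aestronglyMeasurable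
  have h1 : AEStronglyMeasurable (fun ω => (1 + ‖p ω‖) ^ k * ‖a ω + b ω‖) μ := by
    exact (ha.weight_measurable k).aestronglyMeasurable.mul h0.norm
  refine ((ha.integrable k).add (hb.integrable k)).mono' h1 (Eventually.of_forall fun ω => ?_)
  rw [Real.norm_of_nonneg (by positivity), Pi.add_apply, ← mul_add]
  gcongr
  exact norm_add_le _ _

end Moments

section Superposition

variable {E : Type*} [NormedAddCommGroup E] [InnerProductSpace ℝ E] [FiniteDimensional ℝ E]
  [MeasurableSpace E] [BorelSpace E]
  {Ω : Type*} [MeasurableSpace Ω] {μ : Measure Ω} {p : Ω → E} {a : Ω → ℂ}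

theorem HasMoments.aestronglyMeasurable_comp (ha : HasMoments μ p a) {m : E → ℂ}
    (hm : Measurable m) : AEStronglyMeasurable (fun ω => a ω * m (p ω)) μ :=
  ha.aestronglyMeasurable.mul (hm.comp ha.measurable).aestronglyMeasurable

theorem HasMoments.integrable_mul_planeWave (ha : HasMoments μ p a) (x : E) :
    Integrable (fun ω => a ω * planeWave x (p ω)) μ := by
  refine ha.integrable_of_le (C := 1) (n := 0)
    (ha.aestronglyMeasurable_comp (m := fun ξ => planeWave x ξ)
      (by fun_prop : Continuous fun ξ => planeWave x ξ).measurable) fun ω => ?_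
  simp [norm_planeWave]

theorem HasMoments.mul_inner (ha : HasMoments μ p a) (v : E) :
    HasMoments μ p fun ω => a ω * (Complex.I * ((⟪v, p ω⟫ : ℝ) : ℂ)) := by
  refine ha.mul (C := ‖v‖) (n := 1) ?_ fun ω => ?_
  · have : Measurable fun ξ : E => Complex.I * ((⟪v, ξ⟫ : ℝ) : ℂ) :=
      (by fun_prop : Continuous fun ξ : E => Complex.I * ((⟪v, ξ⟫ : ℝ) : ℂ)).measurable
    exact (this.comp ha.measurable).aestronglyMeasurable
  · rw [pow_one]
    exact norm_I_mul_inner_le v (p ω)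

/-- Differentiation of a superposition of plane waves under the integral sign. -/
theorem ofReal_inner_gradient_eq (ha : HasMoments μ p a) {F : E → ℝ}
    (hF : ∀ x, (F x : ℂ) = ∫ ω, a ω * planeWave x (p ω) ∂μ) (x v : E) :
    ((⟪gradient F x, v⟫ : ℝ) : ℂ)
      = ∫ ω, a ω * (Complex.I * ((⟪v, p ω⟫ : ℝ) : ℂ)) * planeWave x (p ω) ∂μ := by
  set F' : E → Ω → E →L[ℝ] ℂ := fun y ω =>
    (a ω * (planeWave y (p ω) * Complex.I)) • Complex.ofRealCLM.comp (innerSL ℝ (p ω)) with hF'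
  have hbound : ∀ ω y, ‖F' y ω‖ ≤ (1 + ‖p ω‖) ^ 1 * ‖a ω‖ := by
    intro ω y
    simp only [hF', norm_smul, norm_mul, norm_planeWave, Complex.norm_I, mul_one]
    have h1 : ‖Complex.ofRealCLM.comp (innerSL ℝ (p ω))‖ ≤ ‖p ω‖ := by
      refine (ContinuousLinearMap.opNorm_comp_le _ _).trans ?_
      rw [Complex.ofRealCLM_norm, innerSL_apply_norm, one_mul]
    nlinarith [norm_nonneg (a ω), mul_le_mul_of_nonneg_left h1 (norm_nonneg (a ω))]
  have hmeas : AEStronglyMeasurable (F' x) μ := by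
    have h1 : Continuous fun ξ : E => Complex.ofRealCLM.comp (innerSL ℝ ξ) := by fun_prop
    have h2 : Continuous fun ξ : E => planeWave x ξ * Complex.I := by fun_prop
    exact (ha.aestronglyMeasurable_comp h2.measurable).smul
      (h1.comp_stronglyMeasurable ha.measurable.stronglyMeasurable).aestronglyMeasurable
  have hInt : Integrable (F' x) μ :=
    (ha.integrable 1).mono' hmeas (Eventually.of_forall fun ω => hbound ω x)
  have hder : HasFDerivAt (fun y => ∫ ω, a ω * planeWave y (p ω) ∂μ) (∫ ω, F' x ω ∂μ) x := by
    refine hasFDerivAt_integral_of_dominated_of_fderiv_le univ_mem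
      (Eventually.of_forall fun y => (ha.integrable_mul_planeWave y).aestronglyMeasurable)
      (ha.integrable_mul_planeWave x) hmeas
      (Eventually.of_forall fun ω y _ => hbound ω y) (ha.integrable 1)
      (Eventually.of_forall fun ω y _ => ?_)
    have := (hasFDerivAt_planeWave y (p ω)).const_mul (a ω)
    rwa [smul_smul] at this
  simp_rw [← hF] at hder
  have hre : HasFDerivAt F (Complex.reCLM.comp (∫ ω, F' x ω ∂μ)) x := by
    have h := HasFDerivAt.comp x (Complex.reCLM.hasFDerivAt (x := ((F x : ℝ) : ℂ))) hder
    exact h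
  have hgrad : ⟪gradient F x, v⟫ = fderiv ℝ F x v := by
    rw [gradient, InnerProductSpace.toDual_symm_apply]
  have h3 : (Complex.ofRealCLM.comp (fderiv ℝ F x)) = ∫ ω, F' x ω ∂μ := by
    have h := HasFDerivAt.comp x (Complex.ofRealCLM.hasFDerivAt (x := F x))
      hre.differentiableAt.hasFDerivAt
    exact h.unique hder
  have h4 : ((fderiv ℝ F x v : ℝ) : ℂ) = (∫ ω, F' x ω ∂μ) v := by rw [← h3]; rfl
  rw [hgrad, h4, ContinuousLinearMap.integral_apply hInt]
  congr 1 with ω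
  simp only [hF', smul_apply, ContinuousLinearMap.comp_apply,
    innerSL_apply_apply, Complex.ofRealCLM_apply, smul_eq_mul, real_inner_comm]
  ring

/-- The symbol `∫ i⟨u,ξ⟩ (e^{i⟨u,ξ⟩} − 1) ν(du)` of the nonlocal part of `Aop ν`. -/
def levySymbol (ν : Measure E) (ξ : E) : ℂ :=
  ∫ u, Complex.I * ((⟪u, ξ⟫ : ℝ) : ℂ) * (planeWave u ξ - 1) ∂ν

theorem norm_inner_mul_planeWave_sub_one_le (u ξ ζ : E) :
    ‖Complex.I * ((⟪u, ξ⟫ : ℝ) : ℂ) * (planeWave u ζ - 1)‖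
      ≤ 2 * (1 + ‖ξ‖) * (1 + ‖ζ‖) * levyWeight u := by
  rw [norm_mul]
  calc _ ≤ (‖u‖ * (1 + ‖ξ‖)) * (2 * (1 + ‖ζ‖) * min ‖u‖ 1) := by
        gcongr
        · exact norm_I_mul_inner_le u ξ
        · exact norm_planeWave_sub_one_le u ζ
    _ = _ := by unfold levyWeight; ring

variable {ν : Measure E}

theorem measurable_levySymbol [SFinite ν] : Measurable (levySymbol ν) := by
  have h : Continuous (Function.uncurry fun ξ u : E =>
      Complex.I * ((⟪u, ξ⟫ : ℝ) : ℂ) * (planeWave u ξ - 1)) := by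
    unfold Function.uncurry
    fun_prop
  exact (h.stronglyMeasurable.integral_prod_right (ν := ν)).measurable

theorem norm_levySymbol_le (hν : Integrable levyWeight ν) (ξ : E) :
    ‖levySymbol ν ξ‖ ≤ 2 * (∫ u, levyWeight u ∂ν) * (1 + ‖ξ‖) ^ 2 := by
  refine (norm_integral_le_of_norm_le (hν.const_mul (2 * (1 + ‖ξ‖) * (1 + ‖ξ‖)))
    (Eventually.of_forall fun u => norm_inner_mul_planeWave_sub_one_le u ξ ξ)).trans ?_
  rw [integral_const_mul]
  apply le_of_eq
  ring

theorem HasMoments.mul_levySymbol [SFinite ν] (hν : Integrable levyWeight ν)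
    (ha : HasMoments μ p a) : HasMoments μ p fun ω => a ω * levySymbol ν (p ω) :=
  ha.mul (measurable_levySymbol.comp ha.measurable).aestronglyMeasurable
    fun ω => norm_levySymbol_le hν (p ω)

/-- The nonlocal part of `Aop ν` acts on superpositions of plane waves as a Fourier
multiplier with symbol `levySymbol ν`. -/
theorem ofReal_integral_gradient_sub_eq [SFinite μ] [SFinite ν] (hν : Integrable levyWeight ν)
    (ha : HasMoments μ p a) {F : E → ℝ}
    (hF : ∀ x, (F x : ℂ) = ∫ ω, a ω * planeWave x (p ω) ∂μ) (x : E) :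
    ((∫ u, ⟪gradient F (x + u) - gradient F x, u⟫ ∂ν : ℝ) : ℂ)
      = ∫ ω, a ω * levySymbol ν (p ω) * planeWave x (p ω) ∂μ := by
  set K : E → Ω → ℂ := fun u ω => a ω * planeWave x (p ω) *
    (Complex.I * ((⟪u, p ω⟫ : ℝ) : ℂ) * (planeWave u (p ω) - 1)) with hK
  have h1 : ∀ u, ((⟪gradient F (x + u) - gradient F x, u⟫ : ℝ) : ℂ) = ∫ ω, K u ω ∂μ := by
    intro u
    rw [inner_sub_left, Complex.ofReal_sub, ofReal_inner_gradient_eq ha hF,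
      ofReal_inner_gradient_eq ha hF, ← integral_sub ((ha.mul_inner u).integrable_mul_planeWave _)
        ((ha.mul_inner u).integrable_mul_planeWave _)]
    congr 1 with ω
    rw [planeWave_add_left]
    ring
  have hKint : Integrable (Function.uncurry K) (ν.prod μ) := by
    refine ((hν.mul_prod (ha.integrable 2)).const_mul 2).mono' ?_
      (Eventually.of_forall fun z => ?_)
    · have hc : Continuous fun z : E × E => planeWave x z.2 *
          (Complex.I * ((⟪z.1, z.2⟫ : ℝ) : ℂ) * (planeWave z.1 z.2 - 1)) := by fun_prop
      have hm := hc.measurable.comp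
        (measurable_fst.prodMk (ha.measurable.comp measurable_snd) :
          Measurable fun z : E × Ω => (z.1, p z.2))
      refine ((ha.aestronglyMeasurable.comp_snd (μ := ν)).mul hm.aestronglyMeasurable).congr
        (Eventually.of_forall fun z => ?_)
      simp only [Pi.mul_apply, Function.comp, Function.uncurry, hK]
      ring
    · have := norm_inner_mul_planeWave_sub_one_le z.1 (p z.2) (p z.2)
      simp only [Function.uncurry, hK]
      rw [norm_mul, norm_mul, norm_planeWave, mul_one]
      refine (mul_le_mul_of_nonneg_left this (norm_nonneg _)).trans (le_of_eq ?_)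
      ring
  rw [← integral_complex_ofReal]
  simp_rw [h1]
  rw [integral_integral_swap hKint]
  congr 1 with ω
  simp only [hK]
  rw [integral_const_mul, levySymbol]
  ring

end Superposition

section PolynomialGrowth

variable {V W : Type*} [NormedAddCommGroup V] [NormedSpace ℝ V] [MeasurableSpace V]
  [NormedAddCommGroup W] [NormedSpace ℝ W] [MeasurableSpace W]

/-- Measurable symbols of at most polynomial growth. -/
structure HasPolyGrowth (m : V → ℂ) : Prop where
  measurable : Measurable m
  bound : ∃ (C : ℝ) (n : ℕ), ∀ v, ‖m v‖ ≤ C * (1 + ‖v‖) ^ n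

theorem HasPolyGrowth.add {m₁ m₂ : V → ℂ} (h₁ : HasPolyGrowth m₁) (h₂ : HasPolyGrowth m₂) :
    HasPolyGrowth fun v => m₁ v + m₂ v := by
  refine ⟨h₁.measurable.add h₂.measurable, ?_⟩
  obtain ⟨C₁, n₁, hb₁⟩ := h₁.bound
  obtain ⟨C₂, n₂, hb₂⟩ := h₂.bound
  refine ⟨|C₁| + |C₂|, n₁ + n₂, fun v => ?_⟩
  have h1 : (1 : ℝ) ≤ 1 + ‖v‖ := by linarith [norm_nonneg v]
  calc ‖m₁ v + m₂ v‖ ≤ C₁ * (1 + ‖v‖) ^ n₁ + C₂ * (1 + ‖v‖) ^ n₂ :=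
        (norm_add_le _ _).trans (add_le_add (hb₁ v) (hb₂ v))
    _ ≤ |C₁| * (1 + ‖v‖) ^ (n₁ + n₂) + |C₂| * (1 + ‖v‖) ^ (n₁ + n₂) := by
        gcongr
        · exact le_abs_self _
        · omega
        · exact le_abs_self _
        · omega
    _ = _ := by ring

theorem HasPolyGrowth.mul {m₁ m₂ : V → ℂ} (h₁ : HasPolyGrowth m₁) (h₂ : HasPolyGrowth m₂) :
    HasPolyGrowth fun v => m₁ v * m₂ v := by
  refine ⟨h₁.measurable.mul h₂.measurable, ?_⟩
  obtain ⟨C₁, n₁, hb₁⟩ := h₁.bound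
  obtain ⟨C₂, n₂, hb₂⟩ := h₂.bound
  refine ⟨C₁ * C₂, n₁ + n₂, fun v => ?_⟩
  rw [norm_mul]
  refine (mul_le_mul (hb₁ v) (hb₂ v) (norm_nonneg _) ((norm_nonneg _).trans (hb₁ v))).trans
    (le_of_eq ?_)
  ring

theorem HasPolyGrowth.const (c : ℂ) : HasPolyGrowth fun _ : V => c :=
  ⟨measurable_const, ‖c‖, 0, fun v => by simp⟩

theorem HasPolyGrowth.sub {m₁ m₂ : V → ℂ} (h₁ : HasPolyGrowth m₁) (h₂ : HasPolyGrowth m₂) :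
    HasPolyGrowth fun v => m₁ v - m₂ v := by
  convert h₁.add ((HasPolyGrowth.const (-1)).mul h₂) using 2
  ring

theorem HasPolyGrowth.comp_clm [OpensMeasurableSpace V] [BorelSpace W] {m : W → ℂ}
    (h : HasPolyGrowth m) (L : V →L[ℝ] W) : HasPolyGrowth fun v => m (L v) := by
  refine ⟨h.measurable.comp L.continuous.measurable, ?_⟩
  obtain ⟨C, n, hb⟩ := h.bound
  refine ⟨|C| * (1 + ‖L‖) ^ n, n, fun v => (hb (L v)).trans ?_⟩
  have h1 : 1 + ‖L v‖ ≤ (1 + ‖L‖) * (1 + ‖v‖) := by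
    nlinarith [L.le_opNorm v, norm_nonneg v, norm_nonneg L]
  calc C * (1 + ‖L v‖) ^ n ≤ |C| * ((1 + ‖L‖) * (1 + ‖v‖)) ^ n := by
        gcongr
        exact le_abs_self C
    _ = _ := by rw [mul_pow]; ring

variable [BorelSpace V] [SecondCountableTopology V] {m : V → ℂ}

theorem HasPolyGrowth.comp_fst (h : HasPolyGrowth m) : HasPolyGrowth fun z : V × V => m z.1 :=
  h.comp_clm (ContinuousLinearMap.fst ℝ V V)

theorem HasPolyGrowth.comp_snd (h : HasPolyGrowth m) : HasPolyGrowth fun z : V × V => m z.2 :=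
  h.comp_clm (ContinuousLinearMap.snd ℝ V V)

theorem HasPolyGrowth.comp_fst_add_snd (h : HasPolyGrowth m) :
    HasPolyGrowth fun z : V × V => m (z.1 + z.2) :=
  h.comp_clm (ContinuousLinearMap.fst ℝ V V + ContinuousLinearMap.snd ℝ V V)

theorem HasPolyGrowth.comp_swap {m : V × V → ℂ} (h : HasPolyGrowth m) :
    HasPolyGrowth fun z : V × V => m z.swap :=
  h.comp_clm ((ContinuousLinearMap.snd ℝ V V).prod (ContinuousLinearMap.fst ℝ V V))

end PolynomialGrowth

section Bilinear

variable {E : Type*} [NormedAddCommGroup E] [InnerProductSpace ℝ E] [FiniteDimensional ℝ E]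
  [MeasurableSpace E] [BorelSpace E] {a b : E → ℂ} {m m₁ m₂ : E × E → ℂ}

theorem one_add_norm_prod_le (z : E × E) : 1 + ‖z‖ ≤ (1 + ‖z.1‖) * (1 + ‖z.2‖) := by
  have h1 := norm_nonneg z.1
  have h2 := norm_nonneg z.2
  rw [Prod.norm_def]
  rcases max_cases ‖z.1‖ ‖z.2‖ with ⟨h, _⟩ | ⟨h, _⟩ <;> rw [h] <;> nlinarith [mul_nonneg h1 h2]

theorem HasMoments.prod (ha : HasMoments volume (fun ξ : E => ξ) a)
    (hb : HasMoments volume (fun ξ : E => ξ) b) (hm : HasPolyGrowth m) :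
    HasMoments ((volume : Measure E).prod (volume : Measure E)) (fun z => z.1 + z.2)
      (fun z => a z.1 * b z.2 * m z) := by
  have hmeas : AEStronglyMeasurable (fun z : E × E => a z.1 * b z.2 * m z)
      ((volume : Measure E).prod (volume : Measure E)) :=
    (ha.aestronglyMeasurable.comp_fst.mul hb.aestronglyMeasurable.comp_snd).mul
      hm.measurable.aestronglyMeasurable
  have hp : Measurable fun z : E × E => z.1 + z.2 := measurable_fst.add measurable_snd
  refine ⟨hp, hmeas, fun k => ?_⟩
  obtain ⟨C, n, h⟩ := hm.bound
  refine (((ha.integrable (k + n)).mul_prod (hb.integrable (k + n))).const_mul |C|).mono'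
    (((hp.norm.const_add 1).pow_const k).aestronglyMeasurable.mul hmeas.norm)
    (Eventually.of_forall fun z => ?_)
  rw [Real.norm_of_nonneg (by positivity), norm_mul, norm_mul]
  have h1 : 1 + ‖z.1 + z.2‖ ≤ (1 + ‖z.1‖) * (1 + ‖z.2‖) := by
    nlinarith [norm_add_le z.1 z.2, mul_nonneg (norm_nonneg z.1) (norm_nonneg z.2)]
  have h2 : ‖m z‖ ≤ |C| * ((1 + ‖z.1‖) * (1 + ‖z.2‖)) ^ n := by
    refine (h z).trans ?_
    gcongr
    · exact le_abs_self C
    · exact one_add_norm_prod_le z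
  calc _ ≤ ((1 + ‖z.1‖) * (1 + ‖z.2‖)) ^ k *
        (‖a z.1‖ * ‖b z.2‖ * (|C| * ((1 + ‖z.1‖) * (1 + ‖z.2‖)) ^ n)) := by gcongr
    _ = _ := by rw [pow_add, pow_add, mul_pow, mul_pow]; ring

/-- The bilinear Fourier multiplier with symbol `m`, applied to the superpositions of plane
waves with densities `a` and `b`. -/
def bilinMult (a b : E → ℂ) (m : E × E → ℂ) (x : E) : ℂ :=
  ∫ z : E × E, a z.1 * b z.2 * m z * planeWave x (z.1 + z.2)
    ∂((volume : Measure E).prod (volume : Measure E))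

theorem bilinMult_add (ha : HasMoments volume (fun ξ : E => ξ) a)
    (hb : HasMoments volume (fun ξ : E => ξ) b) (h₁ : HasPolyGrowth m₁) (h₂ : HasPolyGrowth m₂)
    (x : E) :
    bilinMult a b (fun z => m₁ z + m₂ z) x = bilinMult a b m₁ x + bilinMult a b m₂ x := by
  unfold bilinMult
  rw [← integral_add ((ha.prod hb h₁).integrable_mul_planeWave x)
    ((ha.prod hb h₂).integrable_mul_planeWave x)]
  congr 1 with z
  ring

theorem bilinMult_const_mul (c : ℂ) (x : E) :
    bilinMult a b (fun z => c * m z) x = c * bilinMult a b m x := by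
  unfold bilinMult
  rw [← integral_const_mul]
  congr 1 with z
  ring

theorem bilinMult_sub (ha : HasMoments volume (fun ξ : E => ξ) a)
    (hb : HasMoments volume (fun ξ : E => ξ) b) (h₁ : HasPolyGrowth m₁) (h₂ : HasPolyGrowth m₂)
    (x : E) :
    bilinMult a b (fun z => m₁ z - m₂ z) x = bilinMult a b m₁ x - bilinMult a b m₂ x := by
  unfold bilinMult
  rw [← integral_sub ((ha.prod hb h₁).integrable_mul_planeWave x)
    ((ha.prod hb h₂).integrable_mul_planeWave x)]
  congr 1 with z
  ring

theorem bilinMult_swap (x : E) :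
    bilinMult b a m x = bilinMult a b (fun z => m z.swap) x := by
  unfold bilinMult
  rw [← integral_prod_swap]
  congr 1 with z
  simp only [Prod.fst_swap, Prod.snd_swap]
  rw [add_comm z.2 z.1]
  ring

theorem bilinMult_mul (m₁ m₂ : E → ℂ) (x : E) :
    bilinMult a b (fun z => m₁ z.1 * m₂ z.2) x
      = (∫ ξ, a ξ * m₁ ξ * planeWave x ξ) * ∫ ζ, b ζ * m₂ ζ * planeWave x ζ := by
  unfold bilinMult
  rw [← integral_prod_mul]
  congr 1 with z
  rw [planeWave_add_right]
  ring

variable {ν : Measure E} {K : E → E × E → ℂ} {C : ℝ} {n : ℕ}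

theorem hasPolyGrowth_integral [SFinite ν] (hν : Integrable levyWeight ν)
    (hK : Continuous (Function.uncurry K))
    (hKb : ∀ u z, ‖K u z‖ ≤ C * (1 + ‖z‖) ^ n * levyWeight u) :
    HasPolyGrowth fun z => ∫ u, K u z ∂ν := by
  have h : Continuous (Function.uncurry fun z u => K u z) := hK.comp continuous_swap
  refine ⟨(h.stronglyMeasurable.integral_prod_right (ν := ν)).measurable,
    C * ∫ u, levyWeight u ∂ν, n, fun z => ?_⟩
  refine (norm_integral_le_of_norm_le (hν.const_mul (C * (1 + ‖z‖) ^ n))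
    (Eventually.of_forall fun u => hKb u z)).trans (le_of_eq ?_)
  rw [integral_const_mul]
  ring

theorem integrable_kernel_mul_planeWave [SFinite ν] (hν : Integrable levyWeight ν)
    (hK : Continuous (Function.uncurry K))
    (hKb : ∀ u z, ‖K u z‖ ≤ C * (1 + ‖z‖) ^ n * levyWeight u)
    (ha : HasMoments volume (fun ξ : E => ξ) a) (hb : HasMoments volume (fun ξ : E => ξ) b)
    (x : E) :
    Integrable (Function.uncurry fun (u : E) (z : E × E) =>
      a z.1 * b z.2 * K u z * planeWave x (z.1 + z.2))
      (ν.prod ((volume : Measure E).prod (volume : Measure E))) := by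
  have hmeas : AEStronglyMeasurable (fun w : E × (E × E) =>
      a w.2.1 * b w.2.2 * K w.1 w.2 * planeWave x (w.2.1 + w.2.2))
      (ν.prod ((volume : Measure E).prod (volume : Measure E))) := by
    have h1 : Continuous fun w : E × (E × E) => planeWave x (w.2.1 + w.2.2) := by fun_prop
    exact ((ha.aestronglyMeasurable.comp_fst.mul
      hb.aestronglyMeasurable.comp_snd).comp_snd.mul hK.aestronglyMeasurable).mul
        h1.aestronglyMeasurable
  refine ((hν.mul_prod ((ha.integrable n).mul_prod (hb.integrable n))).const_mul |C|).mono' hmeas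
    (Eventually.of_forall fun w => ?_)
  simp only [Function.uncurry, norm_mul, norm_planeWave, mul_one]
  have h2 : ‖K w.1 w.2‖ ≤ |C| * ((1 + ‖w.2.1‖) * (1 + ‖w.2.2‖)) ^ n * levyWeight w.1 := by
    refine (hKb w.1 w.2).trans ?_
    gcongr
    · exact levyWeight_nonneg _
    · exact le_abs_self C
    · exact one_add_norm_prod_le w.2
  calc _ ≤ ‖a w.2.1‖ * ‖b w.2.2‖ *
        (|C| * ((1 + ‖w.2.1‖) * (1 + ‖w.2.2‖)) ^ n * levyWeight w.1) := by gcongr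
    _ = _ := by rw [mul_pow]; ring

theorem integrable_bilinMult [SFinite ν] (hν : Integrable levyWeight ν)
    (hK : Continuous (Function.uncurry K))
    (hKb : ∀ u z, ‖K u z‖ ≤ C * (1 + ‖z‖) ^ n * levyWeight u)
    (ha : HasMoments volume (fun ξ : E => ξ) a) (hb : HasMoments volume (fun ξ : E => ξ) b)
    (x : E) : Integrable (fun u => bilinMult a b (K u) x) ν :=
  (integrable_kernel_mul_planeWave hν hK hKb ha hb x).integral_prod_left

theorem bilinMult_integral [SFinite ν] (hν : Integrable levyWeight ν)
    (hK : Continuous (Function.uncurry K))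
    (hKb : ∀ u z, ‖K u z‖ ≤ C * (1 + ‖z‖) ^ n * levyWeight u)
    (ha : HasMoments volume (fun ξ : E => ξ) a) (hb : HasMoments volume (fun ξ : E => ξ) b)
    (x : E) :
    bilinMult a b (fun z => ∫ u, K u z ∂ν) x = ∫ u, bilinMult a b (K u) x ∂ν := by
  unfold bilinMult
  rw [integral_integral_swap (integrable_kernel_mul_planeWave hν hK hKb ha hb x)]
  congr 1 with z
  rw [← integral_const_mul, ← integral_mul_const]

end Bilinear

section Commutator

variable {E : Type*} [NormedAddCommGroup E] [InnerProductSpace ℝ E] [FiniteDimensional ℝ E]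
  [MeasurableSpace E] [BorelSpace E] {a b a' b' : E → ℂ} {ν : Measure E}

/-- The symbol `∫ (e^{i⟨u,ξ⟩} − 1)(e^{i⟨u,ζ⟩} − 1) ν(du)`. -/
def crossSymbol (ν : Measure E) (z : E × E) : ℂ :=
  ∫ u, (planeWave u z.1 - 1) * (planeWave u z.2 - 1) ∂ν

/-- The symbol `∫ i⟨u,ξ⟩ e^{i⟨u,ξ⟩} (e^{i⟨u,ζ⟩} − 1) ν(du)`. -/
def driftSymbol (ν : Measure E) (z : E × E) : ℂ :=
  ∫ u, Complex.I * ((⟪u, z.1⟫ : ℝ) : ℂ) * planeWave u z.1 * (planeWave u z.2 - 1) ∂ν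

theorem crossSymbol_swap (z : E × E) : crossSymbol ν z.swap = crossSymbol ν z := by
  unfold crossSymbol
  congr 1 with u
  exact mul_comm _ _

theorem continuous_crossKernel : Continuous (Function.uncurry fun (u : E) (z : E × E) =>
    (planeWave u z.1 - 1) * (planeWave u z.2 - 1)) := by
  unfold Function.uncurry
  fun_prop

theorem continuous_driftKernel : Continuous (Function.uncurry fun (u : E) (z : E × E) =>
    Complex.I * ((⟪u, z.1⟫ : ℝ) : ℂ) * planeWave u z.1 * (planeWave u z.2 - 1)) := by
  unfold Function.uncurry
  fun_prop

theorem one_add_mul_one_add_le (z : E × E) :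
    (1 + ‖z.1‖) * (1 + ‖z.2‖) ≤ (1 + ‖z‖) ^ 2 := by
  rw [sq]
  gcongr
  · exact norm_fst_le z
  · exact norm_snd_le z

theorem norm_crossKernel_le (u : E) (z : E × E) :
    ‖(planeWave u z.1 - 1) * (planeWave u z.2 - 1)‖ ≤ 4 * (1 + ‖z‖) ^ 2 * levyWeight u := by
  rw [norm_mul]
  have h := levyWeight_nonneg u
  calc _ ≤ (2 * (1 + ‖z.1‖) * min ‖u‖ 1) * (2 * (1 + ‖z.2‖) * min ‖u‖ 1) := by
        gcongr <;> exact norm_planeWave_sub_one_le _ _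
    _ = 4 * ((1 + ‖z.1‖) * (1 + ‖z.2‖)) * (min ‖u‖ 1 * min ‖u‖ 1) := by ring
    _ ≤ 4 * (1 + ‖z‖) ^ 2 * (‖u‖ * min ‖u‖ 1) := by
        gcongr
        · exact one_add_mul_one_add_le z
        · exact min_le_left _ _

theorem norm_driftKernel_le (u : E) (z : E × E) :
    ‖Complex.I * ((⟪u, z.1⟫ : ℝ) : ℂ) * planeWave u z.1 * (planeWave u z.2 - 1)‖
      ≤ 2 * (1 + ‖z‖) ^ 2 * levyWeight u := by
  have h0 := levyWeight_nonneg u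
  have h := norm_inner_mul_planeWave_sub_one_le u z.1 z.2
  rw [norm_mul] at h
  rw [norm_mul, norm_mul _ (planeWave u z.1), norm_planeWave, mul_one]
  calc _ ≤ 2 * ((1 + ‖z.1‖) * (1 + ‖z.2‖)) * levyWeight u := by rw [← mul_assoc]; exact h
    _ ≤ _ := by
        gcongr
        exact one_add_mul_one_add_le z

theorem hasPolyGrowth_crossSymbol [SFinite ν] (hν : Integrable levyWeight ν) :
    HasPolyGrowth (crossSymbol ν) :=
  hasPolyGrowth_integral hν continuous_crossKernel norm_crossKernel_le

theorem hasPolyGrowth_driftSymbol [SFinite ν] (hν : Integrable levyWeight ν) :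
    HasPolyGrowth (driftSymbol ν) :=
  hasPolyGrowth_integral hν continuous_driftKernel norm_driftKernel_le

theorem integral_mul_planeWave_sub_one (ha : HasMoments volume (fun ξ : E => ξ) a) (x u : E) :
    ∫ ξ, a ξ * (planeWave u ξ - 1) * planeWave x ξ
      = (∫ ξ, a ξ * planeWave (x + u) ξ) - ∫ ξ, a ξ * planeWave x ξ := by
  rw [← integral_sub (ha.integrable_mul_planeWave (x + u)) (ha.integrable_mul_planeWave x)]
  congr 1 with ξ
  rw [planeWave_add_left]
  ring

/-- The commutator of `−⟨x, ∇⟩`, acting on the first argument, with the bilinear multiplier of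
symbol `crossSymbol ν`. -/
theorem bilinMult_crossSymbol_drift [SFinite ν] (hν : Integrable levyWeight ν)
    (ha : HasMoments volume (fun ξ : E => ξ) a) (ha' : HasMoments volume (fun ξ : E => ξ) a')
    (hb : HasMoments volume (fun ξ : E => ξ) b) {F : E → ℝ}
    (hF : ∀ x, (F x : ℂ) = ∫ ξ, a ξ * planeWave x ξ)
    (hF' : ∀ x, ((-⟪x, gradient F x⟫ : ℝ) : ℂ) = ∫ ξ, a' ξ * planeWave x ξ) (x : E) :
    bilinMult (fun ξ => a ξ * (Complex.I * ((⟪x, ξ⟫ : ℝ) : ℂ))) b (crossSymbol ν) x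
      + bilinMult a' b (crossSymbol ν) x = -bilinMult a b (driftSymbol ν) x := by
  have hax : HasMoments volume (fun ξ : E => ξ)
      (fun ξ => a ξ * (Complex.I * ((⟪x, ξ⟫ : ℝ) : ℂ))) := ha.mul_inner x
  have e1 := bilinMult_integral hν continuous_crossKernel norm_crossKernel_le hax hb x
  have e2 := bilinMult_integral hν continuous_crossKernel norm_crossKernel_le ha' hb x
  have e3 := bilinMult_integral hν continuous_driftKernel norm_driftKernel_le ha hb x
  have i1 := integrable_bilinMult hν continuous_crossKernel norm_crossKernel_le hax hb x
  have i2 := integrable_bilinMult hν continuous_crossKernel norm_crossKernel_le ha' hb x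
  unfold crossSymbol driftSymbol
  rw [e1, e2, e3, ← integral_add i1 i2, ← integral_neg]
  congr 1 with u
  rw [bilinMult_mul (fun ξ => planeWave u ξ - 1) (fun ζ => planeWave u ζ - 1),
    bilinMult_mul (fun ξ => planeWave u ξ - 1) (fun ζ => planeWave u ζ - 1),
    bilinMult_mul (fun ξ => Complex.I * ((⟪u, ξ⟫ : ℝ) : ℂ) * planeWave u ξ)
      (fun ζ => planeWave u ζ - 1), ← add_mul, ← neg_mul]
  congr 1
  have h1 : ∀ y, ∫ ξ, a ξ * (Complex.I * ((⟪x, ξ⟫ : ℝ) : ℂ)) * planeWave y ξ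
      = ((⟪gradient F y, x⟫ : ℝ) : ℂ) := fun y => (ofReal_inner_gradient_eq ha hF y x).symm
  have h2 : ∫ ξ, a ξ * (Complex.I * ((⟪u, ξ⟫ : ℝ) : ℂ) * planeWave u ξ) * planeWave x ξ
      = ((⟪gradient F (x + u), u⟫ : ℝ) : ℂ) := by
    rw [ofReal_inner_gradient_eq ha hF]
    congr 1 with ξ
    rw [planeWave_add_left]
    ring
  rw [integral_mul_planeWave_sub_one hax, integral_mul_planeWave_sub_one ha', h1, h1, h2,
    ← hF', ← hF', inner_add_left, real_inner_comm x, real_inner_comm x, real_inner_comm u]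
  push_cast
  ring

end Commutator

section CarreDuChamp

variable {d : ℕ} {Ω : Type*} [MeasurableSpace Ω] {μ : Measure Ω} [SFinite μ]
  {p : Ω → EuclideanSpace ℝ (Fin d)} {c : Ω → ℂ}
  {a b a' b' : EuclideanSpace ℝ (Fin d) → ℂ} {ν νt : Measure (EuclideanSpace ℝ (Fin d))}
  {F G : EuclideanSpace ℝ (Fin d) → ℝ}

theorem ofReal_Aop_eq [SFinite ν] (hν : Integrable levyWeight ν) (hc : HasMoments μ p c)
    (hF : ∀ x, (F x : ℂ) = ∫ ω, c ω * planeWave x (p ω) ∂μ) (x : EuclideanSpace ℝ (Fin d)) :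
    (Aop ν F x : ℂ) = ∫ ω, c ω *
      (levySymbol ν (p ω) - Complex.I * ((⟪x, p ω⟫ : ℝ) : ℂ)) * planeWave x (p ω) ∂μ := by
  rw [Aop, Complex.ofReal_add, Complex.ofReal_neg, real_inner_comm,
    ofReal_inner_gradient_eq hc hF, ofReal_integral_gradient_sub_eq hν hc hF, neg_add_eq_sub,
    ← integral_sub ((hc.mul_levySymbol hν).integrable_mul_planeWave x)
      ((hc.mul_inner x).integrable_mul_planeWave x)]
  congr 1 with ω
  ring

theorem hasPolyGrowth_levySymbol [SFinite ν] (hν : Integrable levyWeight ν) :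
    HasPolyGrowth (levySymbol ν) :=
  ⟨measurable_levySymbol, _, 2, norm_levySymbol_le hν⟩

theorem hasPolyGrowth_inner (x : EuclideanSpace ℝ (Fin d)) :
    HasPolyGrowth fun ξ => Complex.I * ((⟪x, ξ⟫ : ℝ) : ℂ) :=
  ⟨(by fun_prop : Continuous fun ξ : EuclideanSpace ℝ (Fin d) =>
    Complex.I * ((⟪x, ξ⟫ : ℝ) : ℂ)).measurable, ‖x‖, 1, fun ξ => by
      rw [pow_one]
      exact norm_I_mul_inner_le x ξ⟩

theorem ofReal_Gam1_eq [SFinite ν] (hν : Integrable levyWeight ν)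
    (ha : HasMoments volume (fun ξ => ξ) a) (hb : HasMoments volume (fun ξ => ξ) b)
    (hF : ∀ x, (F x : ℂ) = ∫ ξ, a ξ * planeWave x ξ)
    (hG : ∀ x, (G x : ℂ) = ∫ ξ, b ξ * planeWave x ξ)
    (hS : ∀ ξ ζ, levySymbol ν (ξ + ζ) - levySymbol ν ξ - levySymbol ν ζ = crossSymbol νt (ξ, ζ))
    (x : EuclideanSpace ℝ (Fin d)) :
    (Gam1 ν F G x : ℂ) = 1 / 2 * bilinMult a b (crossSymbol νt) x := by
  set q : EuclideanSpace ℝ (Fin d) → ℂ :=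
    fun ξ => levySymbol ν ξ - Complex.I * ((⟪x, ξ⟫ : ℝ) : ℂ) with hq
  have hqg : HasPolyGrowth q := (hasPolyGrowth_levySymbol hν).sub (hasPolyGrowth_inner x)
  have hone := HasPolyGrowth.const (V := EuclideanSpace ℝ (Fin d) × EuclideanSpace ℝ (Fin d)) 1
  have hFG : ∀ y, ((F y * G y : ℝ) : ℂ) = ∫ z : EuclideanSpace ℝ (Fin d) ×
      EuclideanSpace ℝ (Fin d), a z.1 * b z.2 * 1 * planeWave y (z.1 + z.2)
        ∂(volume.prod volume) := by
    intro y
    rw [Complex.ofReal_mul, hF, hG, ← integral_prod_mul]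
    congr 1 with z
    rw [planeWave_add_right]
    ring
  have e1 : (Aop ν (fun y => F y * G y) x : ℂ) = bilinMult a b (fun z => q (z.1 + z.2)) x := by
    rw [ofReal_Aop_eq hν (ha.prod hb hone) hFG, bilinMult]
    simp only [mul_one, hq]
  have e2 : (F x : ℂ) * (Aop ν G x : ℂ) = bilinMult a b (fun z => q z.2) x := by
    rw [ofReal_Aop_eq hν hb hG, hF]
    have := bilinMult_mul (a := a) (b := b) (fun _ => 1) q x
    simp only [one_mul, mul_one] at this
    exact this.symm
  have e3 : (G x : ℂ) * (Aop ν F x : ℂ) = bilinMult a b (fun z => q z.1) x := by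
    rw [ofReal_Aop_eq hν ha hF, hG, mul_comm]
    have := bilinMult_mul (a := a) (b := b) q (fun _ => 1) x
    simp only [mul_one] at this
    exact this.symm
  have g1 := hqg.comp_fst
  have g2 := hqg.comp_snd
  have g3 := hqg.comp_fst_add_snd
  have key : bilinMult a b (crossSymbol νt) x = bilinMult a b (fun z => q (z.1 + z.2)) x
      - bilinMult a b (fun z => q z.2) x - bilinMult a b (fun z => q z.1) x := by
    rw [← bilinMult_sub ha hb g3 g2, ← bilinMult_sub ha hb (g3.sub g2) g1]
    congr 1 with z
    change crossSymbol νt (z.1, z.2) = q (z.1 + z.2) - q z.2 - q z.1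
    rw [← hS]
    simp only [hq, inner_add_right]
    push_cast
    ring
  rw [Gam1, key]
  push_cast
  rw [e1, e2, e3]
  ring

theorem ofReal_Gam2_eq [SFinite ν] [SFinite νt] (hν : Integrable levyWeight ν)
    (hνt : Integrable levyWeight νt)
    (ha : HasMoments volume (fun ξ => ξ) a) (hb : HasMoments volume (fun ξ => ξ) b)
    (ha' : HasMoments volume (fun ξ => ξ) a') (hb' : HasMoments volume (fun ξ => ξ) b')
    (hF : ∀ x, (F x : ℂ) = ∫ ξ, a ξ * planeWave x ξ)
    (hG : ∀ x, (G x : ℂ) = ∫ ξ, b ξ * planeWave x ξ)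
    (hF' : ∀ x, ((-⟪x, gradient F x⟫ : ℝ) : ℂ) = ∫ ξ, a' ξ * planeWave x ξ)
    (hG' : ∀ x, ((-⟪x, gradient G x⟫ : ℝ) : ℂ) = ∫ ξ, b' ξ * planeWave x ξ)
    (hS : ∀ ξ ζ, levySymbol ν (ξ + ζ) - levySymbol ν ξ - levySymbol ν ζ = crossSymbol νt (ξ, ζ))
    (x : EuclideanSpace ℝ (Fin d)) :
    (Gam2 ν F G x : ℂ) = bilinMult a b (fun z => crossSymbol νt z ^ 2 / 4 +
      (driftSymbol νt z.swap + driftSymbol νt z) / 4) x := by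
  have hA : ∀ {F : EuclideanSpace ℝ (Fin d) → ℝ} {a a' : EuclideanSpace ℝ (Fin d) → ℂ},
      HasMoments volume (fun ξ => ξ) a → HasMoments volume (fun ξ => ξ) a' →
      (∀ x, (F x : ℂ) = ∫ ξ, a ξ * planeWave x ξ) →
      (∀ x, ((-⟪x, gradient F x⟫ : ℝ) : ℂ) = ∫ ξ, a' ξ * planeWave x ξ) →
      ∀ y, (Aop ν F y : ℂ) = ∫ ξ, (a' ξ + a ξ * levySymbol ν ξ) * planeWave y ξ := by
    intro F a a' ha ha' hF hF' y
    rw [Aop, Complex.ofReal_add, hF', ofReal_integral_gradient_sub_eq hν ha hF,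
      ← integral_add (ha'.integrable_mul_planeWave y)
        ((ha.mul_levySymbol hν).integrable_mul_planeWave y)]
    congr 1 with ξ
    ring
  have hsplit : ∀ {a a' b : EuclideanSpace ℝ (Fin d) → ℂ},
      HasMoments volume (fun ξ => ξ) a → HasMoments volume (fun ξ => ξ) a' →
      HasMoments volume (fun ξ => ξ) b →
      bilinMult (fun ξ => a' ξ + a ξ * levySymbol ν ξ) b (crossSymbol νt) x
        = bilinMult a' b (crossSymbol νt) x
          + bilinMult a b (fun z => levySymbol ν z.1 * crossSymbol νt z) x := by
    intro a a' b ha ha' hb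
    have h1 := (ha'.prod hb (hasPolyGrowth_crossSymbol hνt)).integrable_mul_planeWave x
    have h2 := ((ha.mul_levySymbol hν).prod hb
      (hasPolyGrowth_crossSymbol hνt)).integrable_mul_planeWave x
    have h3 : bilinMult a b (fun z => levySymbol ν z.1 * crossSymbol νt z) x
        = bilinMult (fun ξ => a ξ * levySymbol ν ξ) b (crossSymbol νt) x := by
      unfold bilinMult
      congr 1 with z
      ring
    rw [h3]
    unfold bilinMult
    rw [← integral_add h1 h2]
    congr 1 with z
    ring
  have hX := hasPolyGrowth_crossSymbol hνt
  have hD := hasPolyGrowth_driftSymbol hνt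
  have hDs := hD.comp_swap
  have hψ := hasPolyGrowth_levySymbol hν
  have hψ1 := hψ.comp_fst
  have hψ2 := hψ.comp_snd
  have hψ3 := hψ.comp_fst_add_snd
  have hI1 := (hasPolyGrowth_inner x).comp_fst
  have hI2 := (hasPolyGrowth_inner x).comp_snd
  have hΓ : ∀ y, (Gam1 ν F G y : ℂ) = ∫ z : EuclideanSpace ℝ (Fin d) ×
      EuclideanSpace ℝ (Fin d), a z.1 * b z.2 * (1 / 2 * crossSymbol νt z)
        * planeWave y (z.1 + z.2) ∂(volume.prod volume) := by
    intro y
    rw [ofReal_Gam1_eq hν ha hb hF hG hS, ← bilinMult_const_mul, bilinMult]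
  have e1 : (Aop ν (Gam1 ν F G) x : ℂ) = 1 / 2 * (
      bilinMult a b (fun z => levySymbol ν (z.1 + z.2) * crossSymbol νt z) x
      - bilinMult (fun ξ => a ξ * (Complex.I * ((⟪x, ξ⟫ : ℝ) : ℂ))) b (crossSymbol νt) x
      - bilinMult (fun ξ => b ξ * (Complex.I * ((⟪x, ξ⟫ : ℝ) : ℂ))) a (crossSymbol νt) x) := by
    have h1 : bilinMult (fun ξ => a ξ * (Complex.I * ((⟪x, ξ⟫ : ℝ) : ℂ))) b (crossSymbol νt) x
        = bilinMult a b (fun z => Complex.I * ((⟪x, z.1⟫ : ℝ) : ℂ) * crossSymbol νt z) x := by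
      unfold bilinMult
      congr 1 with z
      ring
    have h2 : bilinMult (fun ξ => b ξ * (Complex.I * ((⟪x, ξ⟫ : ℝ) : ℂ))) a (crossSymbol νt) x
        = bilinMult a b (fun z => Complex.I * ((⟪x, z.2⟫ : ℝ) : ℂ) * crossSymbol νt z) x := by
      rw [bilinMult_swap]
      unfold bilinMult
      congr 1 with z
      simp only [crossSymbol_swap]
      ring
    rw [ofReal_Aop_eq hν (ha.prod hb ((HasPolyGrowth.const (1 / 2)).mul hX)) hΓ, h1, h2,
      ← bilinMult_sub ha hb (hψ3.mul hX) (hI1.mul hX),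
      ← bilinMult_sub ha hb ((hψ3.mul hX).sub (hI1.mul hX)) (hI2.mul hX),
      ← bilinMult_const_mul, bilinMult]
    congr 1 with z
    simp only [inner_add_right]
    push_cast
    ring
  have e2 : (Gam1 ν (Aop ν F) G x : ℂ) = 1 / 2 * (bilinMult a' b (crossSymbol νt) x
      + bilinMult a b (fun z => levySymbol ν z.1 * crossSymbol νt z) x) := by
    rw [ofReal_Gam1_eq hν (ha'.add (ha.mul_levySymbol hν)) hb (hA ha ha' hF hF') hG hS,
      hsplit ha ha' hb]
  have e3 : (Gam1 ν (Aop ν G) F x : ℂ) = 1 / 2 * (bilinMult b' a (crossSymbol νt) x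
      + bilinMult a b (fun z => levySymbol ν z.2 * crossSymbol νt z) x) := by
    rw [ofReal_Gam1_eq hν (hb'.add (hb.mul_levySymbol hν)) ha (hA hb hb' hG hG') hF hS,
      hsplit hb hb' ha, bilinMult_swap (a := a) (b := b)]
    simp only [crossSymbol_swap, Prod.fst_swap]
  have c1 := bilinMult_crossSymbol_drift hνt ha ha' hb hF hF' x
  have c2 := bilinMult_crossSymbol_drift hνt hb hb' ha hG hG' x
  rw [bilinMult_swap (a := a) (b := b)] at c2
  have key : bilinMult a b (fun z => crossSymbol νt z ^ 2 / 4 +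
      (driftSymbol νt z.swap + driftSymbol νt z) / 4) x = 1 / 4 * (
        (bilinMult a b (fun z => levySymbol ν (z.1 + z.2) * crossSymbol νt z) x
        - bilinMult a b (fun z => levySymbol ν z.1 * crossSymbol νt z) x
        - bilinMult a b (fun z => levySymbol ν z.2 * crossSymbol νt z) x)
        + (bilinMult a b (fun z => driftSymbol νt z.swap) x
          + bilinMult a b (driftSymbol νt) x)) := by
    rw [← bilinMult_sub ha hb (hψ3.mul hX) (hψ1.mul hX),
      ← bilinMult_sub ha hb ((hψ3.mul hX).sub (hψ1.mul hX)) (hψ2.mul hX),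
      ← bilinMult_add ha hb hDs hD,
      ← bilinMult_add ha hb (((hψ3.mul hX).sub (hψ1.mul hX)).sub (hψ2.mul hX)) (hDs.add hD),
      ← bilinMult_const_mul]
    congr 1 with z
    have := hS z.1 z.2
    rw [Prod.mk.eta] at this
    linear_combination (-(crossSymbol νt z) / 4) * this
  rw [Gam2, key]
  push_cast
  rw [e1, e2, e3]
  linear_combination (1 / 4 : ℂ) * (-c1 - c2)

end CarreDuChamp

section SchwartzDensity

variable {d : ℕ}

/-- The Fourier density of a function, normalized so that `f` is the superposition of the plane
waves with density `fourierDensity f`. -/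
def fourierDensity (f : EuclideanSpace ℝ (Fin d) → ℝ) (ξ : EuclideanSpace ℝ (Fin d)) : ℂ :=
  (((2 * Real.pi) ^ d : ℝ) : ℂ)⁻¹ * FT f ξ

theorem FT_eq_fourier (f : SchwartzMap (EuclideanSpace ℝ (Fin d)) ℝ)
    (ξ : EuclideanSpace ℝ (Fin d)) :
    FT f ξ = FourierTransform.fourier (fun y => (f y : ℂ)) ((2 * Real.pi)⁻¹ • ξ) := by
  rw [Real.fourier_eq', FT]
  congr 1 with y
  rw [smul_eq_mul, mul_comm, real_inner_smul_right, real_inner_comm]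
  congr 2
  have : (Real.pi : ℂ) ≠ 0 := by exact_mod_cast Real.pi_ne_zero
  push_cast
  field_simp

/-- The complexification of a real Schwartz function. -/
def SchwartzMap.complexify (f : SchwartzMap (EuclideanSpace ℝ (Fin d)) ℝ) :
    SchwartzMap (EuclideanSpace ℝ (Fin d)) ℂ :=
  f.postcompCLM Complex.ofRealCLM

theorem SchwartzMap.coe_complexify (f : SchwartzMap (EuclideanSpace ℝ (Fin d)) ℝ) :
    ⇑f.complexify = fun y => (f y : ℂ) := by
  ext y
  simp [SchwartzMap.complexify]

theorem SchwartzMap.hasMoments (T : SchwartzMap (EuclideanSpace ℝ (Fin d)) ℂ) :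
    HasMoments volume (fun ξ => ξ) T := by
  refine ⟨measurable_id, T.continuous.aestronglyMeasurable, fun n => ?_⟩
  have h1 := (SchwartzMap.integrable_pow_mul volume T n).add
    (SchwartzMap.integrable_pow_mul volume T 0)
  refine (h1.const_mul (2 ^ (n - 1))).mono'
    (by have := T.continuous; fun_prop) (Eventually.of_forall fun ξ => ?_)
  rw [Real.norm_of_nonneg (by positivity), Pi.add_apply, pow_zero, ← add_mul, ← mul_assoc]
  gcongr
  have := add_pow_le (norm_nonneg ξ) zero_le_one n
  rw [one_pow] at this
  rwa [add_comm 1]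

theorem FT_eq_schwartz (f : SchwartzMap (EuclideanSpace ℝ (Fin d)) ℝ) :
    ∃ T : SchwartzMap (EuclideanSpace ℝ (Fin d)) ℂ, FT f = T := by
  have h0 : (2 * Real.pi)⁻¹ ≠ 0 := by positivity
  let e : EuclideanSpace ℝ (Fin d) ≃L[ℝ] EuclideanSpace ℝ (Fin d) :=
    ContinuousLinearEquiv.smulLeft (Units.mk0 _ h0)
  refine ⟨SchwartzMap.compCLMOfContinuousLinearEquiv ℝ e
    (FourierTransform.fourier f.complexify), ?_⟩
  ext ξ
  rw [FT_eq_fourier, SchwartzMap.compCLMOfContinuousLinearEquiv_apply, Function.comp_apply,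
    SchwartzMap.fourier_coe, SchwartzMap.coe_complexify]
  rfl

theorem hasMoments_fourierDensity (f : SchwartzMap (EuclideanSpace ℝ (Fin d)) ℝ) :
    HasMoments volume (fun ξ => ξ) (fourierDensity f) := by
  obtain ⟨T, hT⟩ := FT_eq_schwartz f
  have h := ((((2 * Real.pi) ^ d : ℝ) : ℂ)⁻¹ • T).hasMoments
  convert h using 1
  ext ξ
  rw [fourierDensity, hT]
  rfl

theorem ofReal_eq_integral_fourierDensity (f : SchwartzMap (EuclideanSpace ℝ (Fin d)) ℝ)
    (x : EuclideanSpace ℝ (Fin d)) :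
    (f x : ℂ) = ∫ ξ, fourierDensity f ξ * planeWave x ξ := by
  have h0 : (0 : ℝ) < 2 * Real.pi := by positivity
  have h1 : FourierTransformInv.fourierInv (FourierTransform.fourier f.complexify) x
      = f.complexify x := by
    rw [FourierTransform.fourierInv_fourier_eq]
  rw [SchwartzMap.fourierInv_coe, SchwartzMap.fourier_coe, SchwartzMap.coe_complexify] at h1
  refine h1.symm.trans ?_
  rw [Real.fourierInv_eq']
  have h2 := MeasureTheory.Measure.integral_comp_smul (volume : Measure (EuclideanSpace ℝ (Fin d)))
    (fun v => Complex.exp (((2 * Real.pi * ⟪v, x⟫ : ℝ) : ℂ) * Complex.I) •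
      FourierTransform.fourier (fun y => (f y : ℂ)) v) (2 * Real.pi)⁻¹
  rw [finrank_euclideanSpace_fin, abs_of_pos (by positivity), inv_pow, inv_inv] at h2
  have h3 : ∫ ξ, fourierDensity f ξ * planeWave x ξ
      = (((2 * Real.pi) ^ d : ℝ) : ℂ)⁻¹ * ∫ ξ : EuclideanSpace ℝ (Fin d),
        Complex.exp (((2 * Real.pi * ⟪(2 * Real.pi)⁻¹ • ξ, x⟫ : ℝ) : ℂ) * Complex.I) •
        FourierTransform.fourier (fun y => (f y : ℂ)) ((2 * Real.pi)⁻¹ • ξ) := by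
    rw [← integral_const_mul]
    congr 1 with ξ
    rw [fourierDensity, FT_eq_fourier, planeWave, real_inner_smul_left, mul_inv_cancel_left₀ h0.ne',
      real_inner_comm, smul_eq_mul, mul_comm Complex.I]
    ring
  rw [h3, h2, Complex.real_smul, inv_mul_cancel_left₀]
  exact_mod_cast (pow_pos h0 d).ne'

/-- `−⟨x, ∇f(x)⟩` as a Schwartz function. -/
theorem exists_schwartz_neg_inner_gradient (f : SchwartzMap (EuclideanSpace ℝ (Fin d)) ℝ) :
    ∃ h : SchwartzMap (EuclideanSpace ℝ (Fin d)) ℝ, ∀ x, h x = -⟪x, gradient f x⟫ := by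
  refine ⟨-(SchwartzMap.bilinLeftCLM
    (ContinuousLinearMap.id ℝ (EuclideanSpace ℝ (Fin d) →L[ℝ] ℝ))
    Function.HasTemperateGrowth.id (SchwartzMap.fderivCLM ℝ _ ℝ f)), fun x => ?_⟩
  rw [real_inner_comm, gradient, InnerProductSpace.toDual_symm_apply]
  rfl

end SchwartzDensity

section RadialMeasures

variable {τ : Measure ℝ} {κ : ℝ → ℝ}

theorem measure_Ioi_of_Ioc (hτ : ∀ a c : ℝ, 0 < a → a ≤ c → τ (Ioc a c) = ENNReal.ofReal (κ a - κ c))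
    (hκ : Tendsto κ atTop (𝓝 0)) {a : ℝ} (ha : 0 < a) : τ (Ioi a) = ENNReal.ofReal (κ a) := by
  have h1 : Tendsto (fun c => τ (Ioc a c)) atTop (𝓝 (τ (Ioi a))) := by
    rw [← iUnion_Ioc_right]
    exact tendsto_measure_iUnion_atTop fun _ _ hc => Ioc_subset_Ioc_right hc
  refine tendsto_nhds_unique h1 ?_
  have h : Tendsto (fun c => ENNReal.ofReal (κ a - κ c)) atTop (𝓝 (ENNReal.ofReal (κ a - 0))) :=
    ENNReal.tendsto_ofReal (tendsto_const_nhds.sub hκ)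
  rw [sub_zero] at h
  refine h.congr' ?_
  filter_upwards [eventually_ge_atTop a] with c hc
  exact (hτ a c ha hc).symm

theorem sigmaFinite_of_measure_Ioi_lt_top (h0 : τ (Iic 0) = 0) (h : ∀ a, 0 < a → τ (Ioi a) < ∞) :
    SigmaFinite τ := by
  refine ⟨⟨⟨fun n => Iic 0 ∪ Ioi (1 / ((n : ℝ) + 1)), fun _ => trivial, fun n => ?_, ?_⟩⟩⟩
  · exact measure_union_lt_top (by simp [h0]) (h _ (by positivity))
  · refine eq_univ_of_forall fun r => mem_iUnion.2 ?_
    rcases le_or_gt r 0 with hr | hr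
    · exact ⟨0, Or.inl hr⟩
    · obtain ⟨n, hn⟩ := exists_nat_one_div_lt hr
      exact ⟨n, Or.inr hn⟩

theorem lintegral_lintegral_Ioo [SFinite τ] {h : ℝ → ℝ≥0∞} (hh : Measurable h) :
    ∫⁻ r, (∫⁻ t in Ioo 0 r, h t) ∂τ = ∫⁻ t in Ioi 0, h t * τ (Ioi t) := by
  have e1 : ∀ r, ∫⁻ t in Ioo 0 r, h t = ∫⁻ t in Ioi 0, (Iio r).indicator h t := fun r => by
    rw [lintegral_indicator measurableSet_Iio, Measure.restrict_restrict measurableSet_Iio,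
      inter_comm, Ioi_inter_Iio]
  simp_rw [e1]
  have hm : Measurable (Function.uncurry fun r t : ℝ => (Iio r).indicator h t) := by
    have : (Function.uncurry fun r t : ℝ => (Iio r).indicator h t)
        = {p : ℝ × ℝ | p.2 < p.1}.indicator fun p => h p.2 := by
      ext p
      simp [Function.uncurry, indicator]
    rw [this]
    exact (hh.comp measurable_snd).indicator (measurableSet_lt measurable_snd measurable_fst)
  rw [lintegral_lintegral_swap hm.aemeasurable]
  refine lintegral_congr fun t => ?_
  have : ∀ r, (Iio r).indicator h t = (Ioi t).indicator (fun _ => h t) r := fun r => by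
    simp [indicator]
  simp_rw [this]
  rw [lintegral_indicator measurableSet_Ioi, setLIntegral_const]

theorem lintegral_Ioo_comp_mul {r : ℝ} (hr : 0 < r) {h : ℝ → ℝ≥0∞} (hh : Measurable h) :
    ENNReal.ofReal r * ∫⁻ s in Ioo (0 : ℝ) 1, h (s * r) = ∫⁻ t in Ioo 0 r, h t := by
  have e := Real.smul_map_volume_mul_right hr.ne'
  rw [abs_of_pos hr] at e
  rw [← lintegral_indicator measurableSet_Ioo, ← lintegral_indicator measurableSet_Ioo]
  conv_rhs => rw [← e]
  rw [lintegral_smul_measure, lintegral_map (hh.indicator measurableSet_Ioo) (by fun_prop),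
    smul_eq_mul]
  congr 1
  refine lintegral_congr fun s => ?_
  have : s * r ∈ Ioo 0 r ↔ s ∈ Ioo (0 : ℝ) 1 := by
    simp [mul_pos_iff_of_pos_right hr, mul_lt_iff_lt_one_left hr]
  by_cases hs : s ∈ Ioo (0 : ℝ) 1
  · rw [indicator_of_mem hs, indicator_of_mem (this.2 hs)]
  · rw [indicator_of_notMem hs, indicator_of_notMem (mt this.1 hs)]

end RadialMeasures

section PolarMeasures

variable {E : Type*} [NormedAddCommGroup E] [NormedSpace ℝ E] [MeasurableSpace E] [BorelSpace E]
  [SecondCountableTopology E]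
  {ν νt σ : Measure E} {τ : E → Measure ℝ} {k : E → ℝ → ℝ}

theorem lintegral_polar_tail (hσ : σ {x : E | ¬ ‖x‖ = 1} = 0)
    (hkliminfty : ∀ x, ‖x‖ = 1 → Tendsto (k x) atTop (𝓝 0))
    (hpolar : ∀ g : E → ℝ≥0∞, Measurable g →
      ∫⁻ u, g u ∂ν
        = ∫⁻ x, (∫⁻ r in Ioi (0 : ℝ), g (r • x) * ENNReal.ofReal (k x r / r)) ∂σ)
    (hτ : ∀ x : E,
      (∀ a c : ℝ, 0 < a → a ≤ c → τ x (Ioc a c) = ENNReal.ofReal (k x a - k x c))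
        ∧ τ x (Iic 0) = 0)
    (hνt : ∀ g : E → ℝ≥0∞, Measurable g →
      ∫⁻ u, g u ∂νt = ∫⁻ x, (∫⁻ r, g (r • x) ∂(τ x)) ∂σ)
    {g : E → ℝ≥0∞} (hg : Measurable g) :
    ∫⁻ u, ENNReal.ofReal ‖u‖ * (∫⁻ s in Ioo (0 : ℝ) 1, g (s • u)) ∂νt
      = ∫⁻ u, ENNReal.ofReal ‖u‖ * g u ∂ν := by
  have hm : Measurable fun u : E => ∫⁻ s in Ioo (0 : ℝ) 1, g (s • u) := by
    refine Measurable.lintegral_prod_right' (f := fun p : E × ℝ => g (p.2 • p.1)) ?_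
    exact hg.comp (by fun_prop)
  have hn : Measurable fun u : E => ENNReal.ofReal ‖u‖ := by fun_prop
  rw [hνt (fun u => ENNReal.ofReal ‖u‖ * ∫⁻ s in Ioo (0 : ℝ) 1, g (s • u)) (hn.mul hm),
    hpolar (fun u => ENNReal.ofReal ‖u‖ * g u) (hn.mul hg)]
  refine lintegral_congr_ae ?_
  have hx : ∀ᵐ x ∂σ, ‖x‖ = 1 := hσ
  filter_upwards [hx] with x hx
  have hI : ∀ a, 0 < a → τ x (Ioi a) = ENNReal.ofReal (k x a) :=
    fun a ha => measure_Ioi_of_Ioc (hτ x).1 (hkliminfty x hx) ha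
  have : SigmaFinite (τ x) := sigmaFinite_of_measure_Ioi_lt_top (hτ x).2
    fun a ha => (hI a ha).trans_lt ENNReal.ofReal_lt_top
  have hgx : Measurable fun t : ℝ => g (t • x) := hg.comp (by fun_prop)
  have h1 : ∀ᵐ r ∂(τ x), 0 < r := by
    have := (hτ x).2
    rw [← compl_Ioi] at this
    exact this
  calc _ = ∫⁻ r, (∫⁻ t in Ioo 0 r, g (t • x)) ∂(τ x) := by
        refine lintegral_congr_ae ?_
        filter_upwards [h1] with r hr
        rw [norm_smul, hx, mul_one, Real.norm_of_nonneg hr.le, ← lintegral_Ioo_comp_mul hr hgx]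
        simp_rw [smul_smul]
    _ = ∫⁻ t in Ioi 0, g (t • x) * τ x (Ioi t) := lintegral_lintegral_Ioo hgx
    _ = _ := by
        refine setLIntegral_congr_fun measurableSet_Ioi fun r (hr : 0 < r) => ?_
        rw [hI r hr, norm_smul, hx, mul_one, Real.norm_of_nonneg hr.le, mul_comm (ENNReal.ofReal r),
          mul_assoc, ← ENNReal.ofReal_mul hr.le, mul_div_cancel₀ _ hr.ne']

theorem measure_singleton_zero_of_polar (hσ : σ {x : E | ¬ ‖x‖ = 1} = 0)
    (hτ : ∀ x : E, τ x (Iic 0) = 0)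
    (hνt : ∀ g : E → ℝ≥0∞, Measurable g →
      ∫⁻ u, g u ∂νt = ∫⁻ x, (∫⁻ r, g (r • x) ∂(τ x)) ∂σ) : νt {0} = 0 := by
  rw [← lintegral_indicator_one (measurableSet_singleton 0),
    hνt _ (measurable_one.indicator (measurableSet_singleton 0))]
  rw [← lintegral_zero (μ := σ)]
  refine lintegral_congr_ae ?_
  have hx : ∀ᵐ x ∂σ, ‖x‖ = 1 := hσ
  filter_upwards [hx] with x hx
  rw [← lintegral_zero (μ := τ x)]
  refine lintegral_congr_ae ?_
  have h1 : ∀ᵐ r ∂(τ x), 0 < r := by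
    have := hτ x
    rw [← compl_Ioi] at this
    exact this
  filter_upwards [h1] with r hr
  refine indicator_of_notMem ?_ _
  rw [mem_singleton_iff, smul_eq_zero, not_or]
  refine ⟨hr.ne', fun h => ?_⟩
  simp [h] at hx

theorem integrable_levyWeight_of_lintegral {μ : Measure E}
    (h : ∫⁻ u, ENNReal.ofReal (levyWeight u) ∂μ < ∞) : Integrable levyWeight μ := by
  refine ⟨continuous_levyWeight.aestronglyMeasurable, ?_⟩
  rwa [hasFiniteIntegral_iff_ofReal (Eventually.of_forall levyWeight_nonneg)]

theorem sFinite_of_integrable_levyWeight {μ : Measure E} (h : Integrable levyWeight μ)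
    (h0 : μ {0} = 0) : SFinite μ := by
  have hf : IsFiniteMeasure (μ.withDensity fun u => ENNReal.ofReal (levyWeight u)) :=
    isFiniteMeasure_withDensity_ofReal h.2
  refine sFinite_of_absolutelyContinuous
    (ν := μ.withDensity fun u => ENNReal.ofReal (levyWeight u))
    (withDensity_absolutelyContinuous' ?_ ?_)
  · exact continuous_levyWeight.measurable.ennreal_ofReal.aemeasurable
  · have h1 : ∀ᵐ u ∂μ, u ≠ 0 := by
      rw [ae_iff]
      simpa using h0
    filter_upwards [h1] with u hu
    have := norm_pos_iff.2 hu
    have : 0 < levyWeight u := by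
      unfold levyWeight
      positivity
    simpa using this

theorem integrable_levyWeight_of_levy
    (h2 : ∫⁻ u, ENNReal.ofReal (min 1 (‖u‖ ^ 2)) ∂ν < ∞)
    (h1 : ∫⁻ u in {u : E | 1 ≤ ‖u‖}, ENNReal.ofReal ‖u‖ ∂ν < ∞) :
    Integrable levyWeight ν := by
  refine integrable_levyWeight_of_lintegral ?_
  have hs : MeasurableSet {u : E | 1 ≤ ‖u‖} := measurableSet_le measurable_const measurable_norm
  rw [← lintegral_indicator hs] at h1
  refine lt_of_le_of_lt ?_ (ENNReal.add_lt_top.2 ⟨h2, h1⟩)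
  rw [← lintegral_add_left (by fun_prop)]
  refine lintegral_mono fun u => ?_
  unfold levyWeight
  rcases le_or_gt 1 ‖u‖ with h | h
  · rw [indicator_of_mem (show u ∈ {u : E | 1 ≤ ‖u‖} from h), min_eq_right h, mul_one]
    exact le_add_self
  · refine le_trans (le_of_eq ?_) le_self_add
    rw [min_eq_left h.le, min_eq_right (by nlinarith [norm_nonneg u]), sq]

theorem integrable_levyWeight_of_tail (hν : Integrable levyWeight ν)
    (hT : ∀ g : E → ℝ≥0∞, Measurable g →
      ∫⁻ u, ENNReal.ofReal ‖u‖ * (∫⁻ s in Ioo (0 : ℝ) 1, g (s • u)) ∂νt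
        = ∫⁻ u, ENNReal.ofReal ‖u‖ * g u ∂ν) : Integrable levyWeight νt := by
  refine integrable_levyWeight_of_lintegral ?_
  have h1 := hT (fun u => ENNReal.ofReal (min ‖u‖ 1)) (by fun_prop)
  have h2 : ∫⁻ u, ENNReal.ofReal ‖u‖ * ENNReal.ofReal (min ‖u‖ 1) ∂ν < ∞ := by
    simp_rw [← ENNReal.ofReal_mul (norm_nonneg _)]
    exact (hasFiniteIntegral_iff_ofReal (Eventually.of_forall levyWeight_nonneg)).1 hν.2
  rw [← h1] at h2
  have h3 : ∀ u : E, ENNReal.ofReal (levyWeight u) ≤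
      4 * (ENNReal.ofReal ‖u‖ * ∫⁻ s in Ioo (0 : ℝ) 1, ENNReal.ofReal (min ‖s • u‖ 1)) := by
    intro u
    have h4 : ENNReal.ofReal (min ‖u‖ 1 / 2) * volume (Ioo (1 / 2 : ℝ) 1)
        ≤ ∫⁻ s in Ioo (0 : ℝ) 1, ENNReal.ofReal (min ‖s • u‖ 1) := by
      rw [← setLIntegral_const]
      refine (setLIntegral_mono (by fun_prop) fun s hs => ?_).trans
        (lintegral_mono_set (Ioo_subset_Ioo_left (by norm_num)))
      refine ENNReal.ofReal_le_ofReal ?_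
      rw [norm_smul, Real.norm_of_nonneg (by linarith [hs.1])]
      refine le_min ?_ ?_
      · nlinarith [min_le_left ‖u‖ 1, hs.1, norm_nonneg u]
      · linarith [min_le_right ‖u‖ 1]
    rw [Real.volume_Ioo, ← ENNReal.ofReal_mul (by positivity)] at h4
    calc ENNReal.ofReal (levyWeight u)
        = 4 * (ENNReal.ofReal ‖u‖ * ENNReal.ofReal (min ‖u‖ 1 / 2 * (1 - 1 / 2))) := by
          rw [← ENNReal.ofReal_mul (norm_nonneg _),
            show (4 : ℝ≥0∞) = ENNReal.ofReal 4 by norm_num, ← ENNReal.ofReal_mul (by norm_num)]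
          congr 1
          unfold levyWeight
          ring
      _ ≤ _ := by gcongr
  refine (lintegral_mono h3).trans_lt ?_
  rw [lintegral_const_mul' _ _ (by norm_num)]
  exact ENNReal.mul_lt_top (by norm_num) h2

end PolarMeasures

section LevySymbolTail

variable {E : Type*} [NormedAddCommGroup E] [InnerProductSpace ℝ E]
  [FiniteDimensional ℝ E] [MeasurableSpace E] [BorelSpace E] {ν νt : Measure E}

theorem planeWave_smul (s : ℝ) (u ξ : E) : planeWave (s • u) ξ = planeWave u (s • ξ) := by
  rw [planeWave, planeWave, real_inner_smul_left, real_inner_smul_right]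

theorem setIntegral_inner_mul_planeWave_sub_one (u ξ : E) :
    ∫ s in Ioo (0 : ℝ) 1, Complex.I * ((⟪u, ξ⟫ : ℝ) : ℂ) * (planeWave (s • u) ξ - 1)
      = planeWave u ξ - 1 - Complex.I * ((⟪u, ξ⟫ : ℝ) : ℂ) := by
  rw [← integral_Ioc_eq_integral_Ioo, ← intervalIntegral.integral_of_le zero_le_one]
  set w : ℂ := Complex.I * ((⟪u, ξ⟫ : ℝ) : ℂ) with hw
  have e : ∀ s : ℝ, planeWave (s • u) ξ = Complex.exp (s * w) := fun s => by
    rw [planeWave, real_inner_smul_left, hw]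
    push_cast
    ring_nf
  have hd : ∀ s ∈ uIcc (0 : ℝ) 1, HasDerivAt (fun s : ℝ => Complex.exp (s * w) - s * w)
      (w * (planeWave (s • u) ξ - 1)) s := fun s _ => by
    have h1 : HasDerivAt (fun s : ℝ => (s : ℂ) * w) w s := by
      simpa using (Complex.ofRealCLM.hasDerivAt (x := s)).mul_const w
    rw [e]
    exact (h1.cexp.sub h1).congr_deriv (by ring)
  rw [intervalIntegral.integral_eq_sub_of_hasDerivAt hd
    (Continuous.intervalIntegrable (by fun_prop) _ _)]
  have := e 1
  rw [one_smul] at this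
  rw [this]
  simp
  ring

theorem norm_planeWave_sub_one_sub_inner_le (u ξ : E) :
    ‖planeWave u ξ - 1 - Complex.I * ((⟪u, ξ⟫ : ℝ) : ℂ)‖ ≤ 2 * (1 + ‖ξ‖) ^ 2 * levyWeight u := by
  rw [← setIntegral_inner_mul_planeWave_sub_one]
  have h0 := levyWeight_nonneg u
  have h := norm_setIntegral_le_of_norm_le_const (μ := volume) (s := Ioo (0 : ℝ) 1)
    (C := 2 * (1 + ‖ξ‖) ^ 2 * levyWeight u)
    (f := fun s : ℝ => Complex.I * ((⟪u, ξ⟫ : ℝ) : ℂ) * (planeWave (s • u) ξ - 1))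
    (by simp) fun s hs => ?_
  · simpa using h
  · rw [planeWave_smul]
    refine (norm_inner_mul_planeWave_sub_one_le u ξ (s • ξ)).trans ?_
    rw [sq, ← mul_assoc, norm_smul, Real.norm_of_nonneg hs.1.le]
    gcongr
    nlinarith [norm_nonneg ξ, hs.2]

theorem integrable_planeWave_sub_one_sub_inner (hνt : Integrable levyWeight νt) (ξ : E) :
    Integrable (fun u => planeWave u ξ - 1 - Complex.I * ((⟪u, ξ⟫ : ℝ) : ℂ)) νt :=
  (hνt.const_mul (2 * (1 + ‖ξ‖) ^ 2)).mono' (by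
    have : Continuous fun u : E => planeWave u ξ - 1 - Complex.I * ((⟪u, ξ⟫ : ℝ) : ℂ) := by
      fun_prop
    exact this.aestronglyMeasurable)
    (Eventually.of_forall fun u => norm_planeWave_sub_one_sub_inner_le u ξ)

theorem withDensity_norm_eq_map_smul [SFinite νt]
    (hT : ∀ g : E → ℝ≥0∞, Measurable g →
      ∫⁻ u, ENNReal.ofReal ‖u‖ * (∫⁻ s in Ioo (0 : ℝ) 1, g (s • u)) ∂νt
        = ∫⁻ u, ENNReal.ofReal ‖u‖ * g u ∂ν) :
    ν.withDensity (fun u => ENNReal.ofReal ‖u‖) =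
      ((νt.withDensity fun u => ENNReal.ofReal ‖u‖).prod (volume.restrict (Ioo (0 : ℝ) 1))).map
        fun p => p.2 • p.1 := by
  have hn : Measurable fun u : E => ENNReal.ofReal ‖u‖ := by fun_prop
  refine Measure.ext_of_lintegral _ fun g hg => ?_
  have hg2 : Measurable fun p : E × ℝ => g (p.2 • p.1) := hg.comp (by fun_prop)
  rw [lintegral_withDensity_eq_lintegral_mul _ hn hg, lintegral_map hg (by fun_prop),
    lintegral_prod _ hg2.aemeasurable,
    lintegral_withDensity_eq_lintegral_mul _ hn hg2.lintegral_prod_right']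
  exact (hT g hg).symm

theorem levySymbol_eq_integral [SFinite νt] (hν : Integrable levyWeight ν)
    (hT : ∀ g : E → ℝ≥0∞, Measurable g →
      ∫⁻ u, ENNReal.ofReal ‖u‖ * (∫⁻ s in Ioo (0 : ℝ) 1, g (s • u)) ∂νt
        = ∫⁻ u, ENNReal.ofReal ‖u‖ * g u ∂ν) (ξ : E) :
    levySymbol ν ξ = ∫ u, (planeWave u ξ - 1 - Complex.I * ((⟪u, ξ⟫ : ℝ) : ℂ)) ∂νt := by
  have hn : Measurable fun u : E => ENNReal.ofReal ‖u‖ := by fun_prop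
  have htop : ∀ {μ : Measure E}, ∀ᵐ u ∂μ, ENNReal.ofReal ‖u‖ < ∞ :=
    Eventually.of_forall fun _ => ENNReal.ofReal_lt_top
  set G : E → ℂ := fun u => Complex.I * ((⟪‖u‖⁻¹ • u, ξ⟫ : ℝ) : ℂ) * (planeWave u ξ - 1) with hG
  have hGm : Measurable G := by
    have h1 : Measurable fun u : E => ⟪‖u‖⁻¹ • u, ξ⟫ :=
      (measurable_norm.inv.smul measurable_id).inner measurable_const
    have h2 : Measurable fun u : E => planeWave u ξ :=
      (by fun_prop : Continuous fun u : E => planeWave u ξ).measurable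
    exact (h1.complex_ofReal.const_mul _).mul (h2.sub_const 1)
  have hGu : ∀ u, (ENNReal.ofReal ‖u‖).toReal • G u
      = Complex.I * ((⟪u, ξ⟫ : ℝ) : ℂ) * (planeWave u ξ - 1) := fun u => by
    rw [ENNReal.toReal_ofReal (norm_nonneg u), hG, Complex.real_smul]
    rcases eq_or_ne u 0 with rfl | hu
    · simp
    · have : (‖u‖ : ℂ) ≠ 0 := by exact_mod_cast norm_ne_zero_iff.2 hu
      simp only [real_inner_smul_left]
      push_cast
      field_simp
  have hGs : ∀ u, (ENNReal.ofReal ‖u‖).toReal • ∫ s in Ioo (0 : ℝ) 1, G (s • u)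
      = planeWave u ξ - 1 - Complex.I * ((⟪u, ξ⟫ : ℝ) : ℂ) := fun u => by
    rw [← setIntegral_inner_mul_planeWave_sub_one, ← integral_smul]
    refine setIntegral_congr_fun measurableSet_Ioo fun s hs => ?_
    simp only [hG]
    rw [ENNReal.toReal_ofReal (norm_nonneg u), Complex.real_smul]
    rcases eq_or_ne u 0 with rfl | hu
    · simp
    · have h1 : (‖u‖ : ℂ) ≠ 0 := by exact_mod_cast norm_ne_zero_iff.2 hu
      have h2 : (s : ℂ) ≠ 0 := by exact_mod_cast hs.1.ne'
      simp only [real_inner_smul_left, norm_smul, Real.norm_of_nonneg hs.1.le]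
      push_cast
      field_simp
  have hInt : Integrable G (ν.withDensity fun u => ENNReal.ofReal ‖u‖) := by
    rw [integrable_withDensity_iff_integrable_smul₀' hn.aemeasurable htop]
    simp_rw [hGu]
    refine (hν.const_mul (2 * (1 + ‖ξ‖) * (1 + ‖ξ‖))).mono' ?_
      (Eventually.of_forall fun u => norm_inner_mul_planeWave_sub_one_le u ξ ξ)
    exact (by fun_prop : Continuous fun u : E =>
      Complex.I * ((⟪u, ξ⟫ : ℝ) : ℂ) * (planeWave u ξ - 1)).aestronglyMeasurable
  have h1 : levySymbol ν ξ = ∫ u, G u ∂(ν.withDensity fun u => ENNReal.ofReal ‖u‖) := by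
    rw [integral_withDensity_eq_integral_toReal_smul hn htop]
    simp_rw [hGu]
    rfl
  have hsm : Measurable fun p : E × ℝ => p.2 • p.1 := by fun_prop
  rw [withDensity_norm_eq_map_smul hT] at h1 hInt
  rw [integrable_map_measure hGm.aestronglyMeasurable hsm.aemeasurable] at hInt
  rw [h1, integral_map hsm.aemeasurable hGm.aestronglyMeasurable]
  rw [integral_prod (fun p : E × ℝ => G (p.2 • p.1)) hInt,
    integral_withDensity_eq_integral_toReal_smul hn htop]
  simp_rw [hGs]

theorem levySymbol_add_sub [SFinite νt] (hν : Integrable levyWeight ν)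
    (hνt : Integrable levyWeight νt)
    (hT : ∀ g : E → ℝ≥0∞, Measurable g →
      ∫⁻ u, ENNReal.ofReal ‖u‖ * (∫⁻ s in Ioo (0 : ℝ) 1, g (s • u)) ∂νt
        = ∫⁻ u, ENNReal.ofReal ‖u‖ * g u ∂ν) (ξ ζ : E) :
    levySymbol ν (ξ + ζ) - levySymbol ν ξ - levySymbol ν ζ = crossSymbol νt (ξ, ζ) := by
  have hi := integrable_planeWave_sub_one_sub_inner hνt
  rw [levySymbol_eq_integral hν hT, levySymbol_eq_integral hν hT, levySymbol_eq_integral hν hT,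
    ← integral_sub (hi _) (hi _), ← integral_sub]
  rotate_left
  · exact (hi _).sub (hi _)
  · exact hi _
  unfold crossSymbol
  congr 1 with u
  rw [planeWave_add_right, inner_add_right]
  push_cast
  ring

end LevySymbolTail

/-- Representation of the iterated carré du champs `Γ₂` as a pseudo-differential
operator with explicit symbol (`lem:GammaIte`). -/
theorem stmt8 {d : ℕ}
    (ν νt : Measure (EuclideanSpace ℝ (Fin d)))
    (σ : Measure (EuclideanSpace ℝ (Fin d))) [IsFiniteMeasure σ]
    (τ : EuclideanSpace ℝ (Fin d) → Measure ℝ)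
    (k : EuclideanSpace ℝ (Fin d) → ℝ → ℝ)
    (hσ : σ {x : EuclideanSpace ℝ (Fin d) | ¬ ‖x‖ = 1} = 0)
    (hLevy : IsLevyMeasure ν)
    (hν1 : ∫⁻ u in {u : EuclideanSpace ℝ (Fin d) | 1 ≤ ‖u‖}, ENNReal.ofReal ‖u‖ ∂ν < ⊤)
    (hk0 : ∀ x, ∀ r : ℝ, 0 < r → 0 ≤ k x r)
    (hkcr : ∀ x, ContinuousOn (k x) (Ioi 0))
    (hkmono : ∀ x, AntitoneOn (k x) (Ioi 0))
    (hkcx : ∀ r : ℝ, 0 < r →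
      ContinuousOn (fun x => k x r) {x : EuclideanSpace ℝ (Fin d) | ‖x‖ = 1})
    (hklim0 : ∀ x, ‖x‖ = 1 → Tendsto (fun r => r ^ 2 * k x r) (𝓝[>] 0) (𝓝 0))
    (hkliminfty : ∀ x, ‖x‖ = 1 → Tendsto (k x) atTop (𝓝 0))
    (hpolar : ∀ g : EuclideanSpace ℝ (Fin d) → ℝ≥0∞, Measurable g →
      ∫⁻ u, g u ∂ν
        = ∫⁻ x, (∫⁻ r in Ioi (0 : ℝ), g (r • x) * ENNReal.ofReal (k x r / r)) ∂σ)
    (hτ : ∀ x : EuclideanSpace ℝ (Fin d),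
      (∀ a c : ℝ, 0 < a → a ≤ c → τ x (Ioc a c) = ENNReal.ofReal (k x a - k x c))
        ∧ τ x (Iic 0) = 0)
    (hνt : ∀ g : EuclideanSpace ℝ (Fin d) → ℝ≥0∞, Measurable g →
      ∫⁻ u, g u ∂νt = ∫⁻ x, (∫⁻ r, g (r • x) ∂(τ x)) ∂σ) :
    ∀ (f g : SchwartzMap (EuclideanSpace ℝ (Fin d)) ℝ) (x : EuclideanSpace ℝ (Fin d)),
      ((Gam2 ν (⇑f) (⇑g) x : ℝ) : ℂ)
        = (((2 * Real.pi) ^ (2 * d) : ℝ) : ℂ)⁻¹ *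
            ∫ ξ, (∫ ζ, FT (⇑f) ξ * FT (⇑g) ζ
              * Complex.exp (Complex.I * ((⟪x, ξ + ζ⟫ : ℝ) : ℂ))
              * ((∫ u, (Complex.exp (Complex.I * ((⟪u, ξ⟫ : ℝ) : ℂ)) - 1)
                    * (Complex.exp (Complex.I * ((⟪u, ζ⟫ : ℝ) : ℂ)) - 1) ∂νt) ^ 2 / 4
                + ((∫ u, Complex.I * ((⟪u, ζ⟫ : ℝ) : ℂ)
                      * Complex.exp (Complex.I * ((⟪u, ζ⟫ : ℝ) : ℂ))
                      * (Complex.exp (Complex.I * ((⟪u, ξ⟫ : ℝ) : ℂ)) - 1) ∂νt)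
                    + ∫ u, Complex.I * ((⟪u, ξ⟫ : ℝ) : ℂ)
                      * Complex.exp (Complex.I * ((⟪u, ξ⟫ : ℝ) : ℂ))
                      * (Complex.exp (Complex.I * ((⟪u, ζ⟫ : ℝ) : ℂ)) - 1) ∂νt) / 4)) := by
  have hT := fun (g : EuclideanSpace ℝ (Fin d) → ℝ≥0∞) (hg : Measurable g) =>
    lintegral_polar_tail hσ hkliminfty hpolar hτ hνt hg
  have hνw : Integrable levyWeight ν := integrable_levyWeight_of_levy hLevy.2 hν1
  have hνtw : Integrable levyWeight νt := integrable_levyWeight_of_tail hνw hT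
  have : SFinite ν := sFinite_of_integrable_levyWeight hνw hLevy.1
  have : SFinite νt := sFinite_of_integrable_levyWeight hνtw
    (measure_singleton_zero_of_polar hσ (fun x => (hτ x).2) hνt)
  intro f g x
  obtain ⟨f', hf'⟩ := exists_schwartz_neg_inner_gradient f
  obtain ⟨g', hg'⟩ := exists_schwartz_neg_inner_gradient g
  have ha := hasMoments_fourierDensity f
  have hb := hasMoments_fourierDensity g
  have hX := hasPolyGrowth_crossSymbol hνtw
  have hD := hasPolyGrowth_driftSymbol hνtw
  have hm : HasPolyGrowth fun z => crossSymbol νt z ^ 2 / 4 +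
      (driftSymbol νt z.swap + driftSymbol νt z) / 4 := by
    have h := ((HasPolyGrowth.const (1 / 4)).mul (hX.mul hX)).add
      ((HasPolyGrowth.const (1 / 4)).mul (hD.comp_swap.add hD))
    convert h using 2
    ring
  rw [ofReal_Gam2_eq hνw hνtw ha hb (hasMoments_fourierDensity f') (hasMoments_fourierDensity g')
    (ofReal_eq_integral_fourierDensity f) (ofReal_eq_integral_fourierDensity g)
    (fun y => by rw [← hf', ofReal_eq_integral_fourierDensity])
    (fun y => by rw [← hg', ofReal_eq_integral_fourierDensity])
    (levySymbol_add_sub hνw hνtw hT) x, bilinMult,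
    integral_prod _ ((ha.prod hb hm).integrable_mul_planeWave x), ← integral_const_mul]
  congr 1 with ξ
  rw [← integral_const_mul]
  congr 1 with ζ
  simp only [fourierDensity, crossSymbol, driftSymbol, planeWave, Prod.fst_swap, Prod.snd_swap]
  have hc : (((2 * Real.pi) ^ (2 * d) : ℝ) : ℂ)⁻¹
      = (((2 * Real.pi) ^ d : ℝ) : ℂ)⁻¹ * (((2 * Real.pi) ^ d : ℝ) : ℂ)⁻¹ := by
    rw [two_mul d, pow_add, Complex.ofReal_mul, mul_inv]
  rw [hc]
  ring
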